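/- Let M be a spacelike surface in ℝ^{3,1} with a canonical normal null direction Z such that a ≠ 0. Then the complex quadratic form G*H satisfies H(dG(Z^⊤),dG(Z^⊤)) = 0, H(dG(W),dG(W)) = 2(2|H⃗|² − K) − i·2K_N, and H(dG(Z^⊤),dG(W)) = −K_N + iK; consequently its discriminant satisfies disc G*H := −det G*H = −(K + iK_N)². -/

import Mathlib

noncomputable section

/-- Points of the parameter domain of the surface chart. -/
abbrev Pt : Type := ℝ × ℝ

/-- Vectors of the Minkowski space `ℝ^{3,1}`. -/
abbrev E4 : Type := Fin 4 → ℝ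

/-- The Minkowski bilinear form of signature `(+,+,+,-)` on `ℝ⁴`. -/
def mink (v w : E4) : ℝ := v 0 * w 0 + v 1 * w 1 + v 2 * w 2 - v 3 * w 3

/-- Realization in `ℝ^{3,1}` of a coordinate vector field `X` along the immersion `ψ`. -/
def vecF (ψ : Pt → E4) (X : Pt → Pt) : Pt → E4 := fun p => fderiv ℝ ψ p (X p)

/-- Flat (ambient) derivative of an `ℝ⁴`-valued field along a coordinate vector field. -/
def Dflat (X : Pt → Pt) (V : Pt → E4) : Pt → E4 := fun p => fderiv ℝ V p (X p)

/-- Second fundamental form `B(X,Y) = ∇̄_X Y − ∇_X Y`. -/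
def sff (ψ : Pt → E4) (conn : (Pt → Pt) → (Pt → Pt) → Pt → Pt) (X Y : Pt → Pt) : Pt → E4 :=
  fun p => Dflat X (vecF ψ Y) p - vecF ψ (conn X Y) p

/-- `v` is tangent to the surface at `p`. -/
def isTangentV (ψ : Pt → E4) (p : Pt) (v : E4) : Prop := ∃ w : Pt, fderiv ℝ ψ p w = v

/-- `v` is normal to the surface at `p`. -/
def isNormalV (ψ : Pt → E4) (p : Pt) (v : E4) : Prop := ∀ w : Pt, mink v (fderiv ℝ ψ p w) = 0

/-- Lie bracket of coordinate vector fields on the chart. -/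
def lieB (X Y : Pt → Pt) : Pt → Pt := fun p => fderiv ℝ Y p (X p) - fderiv ℝ X p (Y p)

/-- Curvature tensor `R(X,Y)V = ∇_Y∇_X V − ∇_X∇_Y V + ∇_{[X,Y]}V`. -/
def curvR (conn : (Pt → Pt) → (Pt → Pt) → Pt → Pt) (X Y V : Pt → Pt) : Pt → Pt :=
  fun p => conn Y (conn X V) p - conn X (conn Y V) p + conn (lieB X Y) V p

/-- Normal curvature tensor `R^⊥(X,Y)ν = ∇⊥_Y∇⊥_X ν − ∇⊥_X∇⊥_Y ν + ∇⊥_{[X,Y]}ν`. -/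
def curvRperp (nconn : (Pt → Pt) → (Pt → E4) → Pt → E4) (X Y : Pt → Pt) (ν : Pt → E4) :
    Pt → E4 :=
  fun p => nconn Y (nconn X ν) p - nconn X (nconn Y ν) p + nconn (lieB X Y) ν p

/-- Determinant of four vectors of `ℝ⁴` (the volume form `e₁∧e₂∧e₃∧e₄ ↦ 1`). -/
def det4 (a b c d : E4) : ℝ := Matrix.det (Matrix.of ![a, b, c, d])

/-- A spacelike surface in `ℝ^{3,1}`, given by a chart `ψ : U → ℝ^{3,1}`, endowed with a
canonical normal null direction with respect to the constant unit spacelike vector `Z`,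
together with all the associated geometric data: the Levi-Civita connection `conn`,
the normal connection `nconn`, the tangent part `Z^⊤` (coordinates `ZT`), the oriented
orthonormal completion `W` (coordinates `Wc`), the shape operator `shA = A_{Z^⊥}`,
the 1-form `β` with `B(X,Z^⊤) = β(X)Z^⊥`, and the lightlike normal field `W'` with
`⟨Z^⊥,W'⟩ = 1`.  Each piece of data is characterized by its defining property. -/
structure CNND where
  U : Set Pt
  hUopen : IsOpen U
  ψ : Pt → E4
  hψ : ContDiffOn ℝ (⊤ : ℕ∞) ψ U
  himm : ∀ p ∈ U, ∀ v : Pt, fderiv ℝ ψ p v = 0 → v = 0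
  hspacelike : ∀ p ∈ U, ∀ v : Pt, v ≠ 0 → 0 < mink (fderiv ℝ ψ p v) (fderiv ℝ ψ p v)
  /-- Levi-Civita connection of the induced metric, as the tangent part of the flat one. -/
  conn : (Pt → Pt) → (Pt → Pt) → Pt → Pt
  hconn : ∀ X Y, ∀ p ∈ U, DifferentiableAt ℝ (vecF ψ Y) p → isNormalV ψ p (sff ψ conn X Y p)
  hconnSmooth : ∀ X Y, ContDiffOn ℝ (⊤ : ℕ∞) X U → ContDiffOn ℝ (⊤ : ℕ∞) Y U → ContDiffOn ℝ (⊤ : ℕ∞) (conn X Y) U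
  /-- Normal connection: the normal part of the flat derivative of a normal field. -/
  nconn : (Pt → Pt) → (Pt → E4) → Pt → E4
  hnconn : ∀ X ν, ∀ p ∈ U, (∀ q ∈ U, isNormalV ψ q (ν q)) → DifferentiableAt ℝ ν p →
    isNormalV ψ p (nconn X ν p) ∧ isTangentV ψ p (Dflat X ν p - nconn X ν p)
  hnconnSmooth : ∀ X ν, ContDiffOn ℝ (⊤ : ℕ∞) X U → (∀ q ∈ U, isNormalV ψ q (ν q)) →
    ContDiffOn ℝ (⊤ : ℕ∞) ν U → ContDiffOn ℝ (⊤ : ℕ∞) (nconn X ν) U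
  /-- The parallel (constant) vector field `Z`, a unit spacelike vector. -/
  Z : E4
  hZunit : mink Z Z = 1
  /-- Coordinates of the tangent part `Z^⊤` of `Z`; `Z^⊥ = Z − Z^⊤` is normal. -/
  ZT : Pt → Pt
  hZTsmooth : ContDiffOn ℝ (⊤ : ℕ∞) ZT U
  hZTtangentpart : ∀ p ∈ U, isNormalV ψ p (Z - fderiv ℝ ψ p (ZT p))
  /-- canonical normal null direction: `Z^⊥` is lightlike … -/
  hZperpNull : ∀ p ∈ U, mink (Z - fderiv ℝ ψ p (ZT p)) (Z - fderiv ℝ ψ p (ZT p)) = 0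
  /-- … and nowhere zero. -/
  hZperpNe : ∀ p ∈ U, Z - fderiv ℝ ψ p (ZT p) ≠ 0
  /-- Coordinates of the unit tangent field `W` orthogonal to `Z^⊤`, positively oriented. -/
  Wc : Pt → Pt
  hWsmooth : ContDiffOn ℝ (⊤ : ℕ∞) Wc U
  hWunit : ∀ p ∈ U, mink (fderiv ℝ ψ p (Wc p)) (fderiv ℝ ψ p (Wc p)) = 1
  hWorth : ∀ p ∈ U, mink (fderiv ℝ ψ p (ZT p)) (fderiv ℝ ψ p (Wc p)) = 0
  hWorient : ∀ p ∈ U, 0 < (ZT p).1 * (Wc p).2 - (ZT p).2 * (Wc p).1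
  /-- The shape operator `A_{Z^⊥}`: `⟨A_{Z^⊥}X, Y⟩ = ⟨B(X,Y), Z^⊥⟩`. -/
  shA : (Pt → Pt) → Pt → Pt
  hshA : ∀ X Y, ∀ p ∈ U, DifferentiableAt ℝ (vecF ψ Y) p →
    mink (fderiv ℝ ψ p (shA X p)) (fderiv ℝ ψ p (Y p)) =
      mink (sff ψ conn X Y p) (Z - fderiv ℝ ψ p (ZT p))
  /-- The 1-form `β` with `B(X, Z^⊤) = β(X) Z^⊥`. -/
  beta : Pt → Pt → ℝ
  hbeta : ∀ X, ∀ p ∈ U, sff ψ conn X ZT p = beta p (X p) • (Z - fderiv ℝ ψ p (ZT p))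
  /-- The lightlike normal field `W'` with `⟨Z^⊥, W'⟩ = 1`, such that
  `(Z^⊤, W, (Z^⊥+W')/√2, (Z^⊥−W')/√2)` is a positively oriented orthonormal frame. -/
  Wp : Pt → E4
  hWpNormal : ∀ p ∈ U, isNormalV ψ p (Wp p)
  hWpNull : ∀ p ∈ U, mink (Wp p) (Wp p) = 0
  hWpPair : ∀ p ∈ U, mink (Z - fderiv ℝ ψ p (ZT p)) (Wp p) = 1
  hWpOrient : ∀ p ∈ U, 0 < det4 (fderiv ℝ ψ p (ZT p)) (fderiv ℝ ψ p (Wc p))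
    ((Real.sqrt 2)⁻¹ • ((Z - fderiv ℝ ψ p (ZT p)) + Wp p))
    ((Real.sqrt 2)⁻¹ • ((Z - fderiv ℝ ψ p (ZT p)) - Wp p))

namespace CNND

variable (S : CNND)

/-- The normal part `Z^⊥` of `Z` along the surface. -/
def Zperp : Pt → E4 := fun p => S.Z - fderiv ℝ S.ψ p (S.ZT p)

/-- The second fundamental form of the surface. -/
def B : (Pt → Pt) → (Pt → Pt) → Pt → E4 := sff S.ψ S.conn

/-- The function `a = α(W) = ⟨B(W,W), Z^⊥⟩`. -/
def afun : Pt → ℝ := fun p => mink (S.B S.Wc S.Wc p) (S.Zperp p)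

/-- The 1-form `α(X) = ⟨B(X,W), Z^⊥⟩`. -/
def alphaF (X : Pt → Pt) : Pt → ℝ := fun p => mink (S.B X S.Wc p) (S.Zperp p)

/-- The mean curvature vector `H⃗ = (1/2)(B(Z^⊤,Z^⊤) + B(W,W))`. -/
def Hvec : Pt → E4 := fun p => (1 / 2 : ℝ) • (S.B S.ZT S.ZT p + S.B S.Wc S.Wc p)

/-- The Gauss curvature `K = ⟨R(Z^⊤,W)Z^⊤, W⟩`. -/
def Kfun : Pt → ℝ := fun p =>
  mink (fderiv ℝ S.ψ p (curvR S.conn S.ZT S.Wc S.ZT p)) (fderiv ℝ S.ψ p (S.Wc p))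

/-- The normal curvature `K_N = ⟨R^⊥(Z^⊤,W)Z^⊥, W'⟩`. -/
def KNfun : Pt → ℝ := fun p => mink (curvRperp S.nconn S.ZT S.Wc S.Zperp p) (S.Wp p)

end CNND

/-- The wedge `v ∧ w` of two vectors of `ℝ⁴`, as an antisymmetric matrix (bivector). -/
def wedge2 (v w : E4) : Fin 4 → Fin 4 → ℝ := fun i j => v i * w j - v j * w i

/-- The Gauss map `G = Z^⊤ ∧ W : M → Λ²ℝ^{3,1}`. -/
def CNND.Gmap (S : CNND) : Pt → Fin 4 → Fin 4 → ℝ :=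
  fun p => wedge2 (fderiv ℝ S.ψ p (S.ZT p)) (fderiv ℝ S.ψ p (S.Wc p))

/-- The signs of the Minkowski metric. -/
def epsM : Fin 4 → ℝ := fun i => if i = 3 then -1 else 1

/-- The induced (signature `(3,3)`) inner product on bivectors of `ℝ^{3,1}`:
`⟨v∧w, v'∧w'⟩ = ⟨v,v'⟩⟨w,w'⟩ − ⟨v,w'⟩⟨w,v'⟩`. -/
def binner (η η' : Fin 4 → Fin 4 → ℝ) : ℝ :=
  (1 / 2) * ∑ i : Fin 4, ∑ j : Fin 4, epsM i * epsM j * η i j * η' i j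

/-- The wedge product `Λ²ℝ^{3,1} × Λ²ℝ^{3,1} → Λ⁴ℝ^{3,1} ≅ ℝ`, normalized so that
`(v∧w)∧(v'∧w') = det(v,w,v',w')`. -/
def bwedge (η η' : Fin 4 → Fin 4 → ℝ) : ℝ :=
  (1 / 4) * ∑ σ : Equiv.Perm (Fin 4),
    ((Equiv.Perm.sign σ : ℤ) : ℝ) * η (σ 0) (σ 1) * η' (σ 2) (σ 3)

/-- The `ℂ`-bilinear form `H(η,η') = ⟨η,η'⟩ + i η∧η'` on bivectors, where `i = −⋆`. -/
def HformC (η η' : Fin 4 → Fin 4 → ℝ) : ℂ :=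
  (binner η η' : ℝ) + (bwedge η η' : ℝ) * Complex.I

/-- The quadratic form `δ(u) = dG(u) ∧ dG(u)` whose zero directions are the asymptotic
directions. -/
def CNND.deltaQ (S : CNND) (p : Pt) (u : Pt) : ℝ :=
  bwedge (fderiv ℝ S.Gmap p u) (fderiv ℝ S.Gmap p u)

section MinkowskiAlgebra

lemma mink_comm (v w : E4) : mink v w = mink w v := by
  unfold mink; ring

lemma mink_add_left (u v w : E4) : mink (u + v) w = mink u w + mink v w := by
  simp only [mink, Pi.add_apply]; ring

lemma mink_sub_left (u v w : E4) : mink (u - v) w = mink u w - mink v w := by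
  simp only [mink, Pi.sub_apply]; ring

lemma mink_neg_left (v w : E4) : mink (-v) w = -mink v w := by
  simp only [mink, Pi.neg_apply]; ring

lemma mink_smul_left (c : ℝ) (v w : E4) : mink (c • v) w = c * mink v w := by
  simp only [mink, Pi.smul_apply, smul_eq_mul]; ring

lemma mink_add_right (u v w : E4) : mink u (v + w) = mink u v + mink u w := by
  simp only [mink, Pi.add_apply]; ring

lemma mink_sub_right (u v w : E4) : mink u (v - w) = mink u v - mink u w := by
  simp only [mink, Pi.sub_apply]; ring

lemma mink_smul_right (c : ℝ) (v w : E4) : mink v (c • w) = c * mink v w := by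
  simp only [mink, Pi.smul_apply, smul_eq_mul]; ring

lemma mink_zero_left (w : E4) : mink 0 w = 0 := by
  simp [mink]

/-- Leibniz rule for the Minkowski product of two vector fields. -/
lemma fderiv_mink {V V' : Pt → E4} {p : Pt} (hV : DifferentiableAt ℝ V p)
    (hV' : DifferentiableAt ℝ V' p) (u : Pt) :
    fderiv ℝ (fun q => mink (V q) (V' q)) p u =
      mink (fderiv ℝ V p u) (V' p) + mink (V p) (fderiv ℝ V' p u) := by
  have h := hasFDerivAt_pi'.1 hV.hasFDerivAt
  have h' := hasFDerivAt_pi'.1 hV'.hasFDerivAt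
  have key := ((((h 0).mul (h' 0)).add ((h 1).mul (h' 1))).add ((h 2).mul (h' 2))).sub
    ((h 3).mul (h' 3))
  have e : fderiv ℝ (fun q => mink (V q) (V' q)) p = _ := key.fderiv
  rw [e]
  simp [mink]
  ring

/-- If the Minkowski product of two fields is constant on an open set, its Leibniz
expansion vanishes there. -/
lemma mink_deriv_eq_zero {U : Set Pt} (hU : IsOpen U) {V V' : Pt → E4} {c : ℝ}
    (hc : ∀ q ∈ U, mink (V q) (V' q) = c) {p : Pt} (hp : p ∈ U)
    (hV : DifferentiableAt ℝ V p) (hV' : DifferentiableAt ℝ V' p) (u : Pt) :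
    mink (fderiv ℝ V p u) (V' p) + mink (V p) (fderiv ℝ V' p u) = 0 := by
  rw [← fderiv_mink hV hV' u]
  have : (fun q => mink (V q) (V' q)) =ᶠ[nhds p] fun _ => c :=
    Filter.eventually_of_mem (hU.mem_nhds hp) hc
  rw [this.fderiv_eq]
  simp

lemma det4_eq (a b c d : E4) : det4 a b c d =
    a 0 * (b 1 * (c 2 * d 3 - c 3 * d 2) - b 2 * (c 1 * d 3 - c 3 * d 1)
      + b 3 * (c 1 * d 2 - c 2 * d 1))
    - a 1 * (b 0 * (c 2 * d 3 - c 3 * d 2) - b 2 * (c 0 * d 3 - c 3 * d 0)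
      + b 3 * (c 0 * d 2 - c 2 * d 0))
    + a 2 * (b 0 * (c 1 * d 3 - c 3 * d 1) - b 1 * (c 0 * d 3 - c 3 * d 0)
      + b 3 * (c 0 * d 1 - c 1 * d 0))
    - a 3 * (b 0 * (c 1 * d 2 - c 2 * d 1) - b 1 * (c 0 * d 2 - c 2 * d 0)
      + b 2 * (c 0 * d 1 - c 1 * d 0)) := by
  unfold det4
  simp [Matrix.det_succ_row_zero, Fin.sum_univ_succ, Fin.succAbove]
  ring

lemma sum_perm_eq_det4 (a b c d : E4) :
    ∑ σ : Equiv.Perm (Fin 4), ((Equiv.Perm.sign σ : ℤ) : ℝ) *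
      (a (σ 0) * b (σ 1) * c (σ 2) * d (σ 3)) = det4 a b c d := by
  unfold det4
  rw [← Matrix.det_transpose, Matrix.det_apply']
  refine Finset.sum_congr rfl fun σ _ => ?_
  simp [Fin.prod_univ_four]

lemma bwedge_wedge2 (a b c d : E4) : bwedge (wedge2 a b) (wedge2 c d) = det4 a b c d := by
  have h : bwedge (wedge2 a b) (wedge2 c d) =
      (1 / 4) * (det4 a b c d - det4 b a c d - det4 a b d c + det4 b a d c) := by
    simp only [← sum_perm_eq_det4, ← Finset.sum_sub_distrib, ← Finset.sum_add_distrib]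
    unfold bwedge wedge2
    congr 1
    refine Finset.sum_congr rfl fun σ _ => ?_
    ring
  rw [h]
  simp only [det4_eq]
  ring

lemma binner_wedge2 (a b c d : E4) :
    binner (wedge2 a b) (wedge2 c d) = mink a c * mink b d - mink a d * mink b c := by
  simp [binner, wedge2, mink, epsM, Fin.sum_univ_four]
  ring

/-- A Witt frame of `ℝ^{3,1}`: two orthonormal spacelike vectors `t`, `w` and two null vectors
`n`, `m` orthogonal to them with `⟨n, m⟩ = 1`. -/
structure IsWittFrame (t w n m : E4) : Prop where
  tt : mink t t = 1
  ww : mink w w = 1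
  tw : mink t w = 0
  tn : mink t n = 0
  tm : mink t m = 0
  wn : mink w n = 0
  wm : mink w m = 0
  nn : mink n n = 0
  mm : mink m m = 0
  nm : mink n m = 1

namespace IsWittFrame

variable {t w n m : E4}

lemma det4_sq (h : IsWittFrame t w n m) : det4 t w n m ^ 2 = 1 := by
  obtain ⟨tt, ww, tw, tn, tm, wn, wm, nn, mm, nm⟩ := h
  have hG : Matrix.of ![t, w, n, m] * Matrix.diagonal epsM * (Matrix.of ![t, w, n, m]).transpose =
      !![1, 0, 0, 0; 0, 1, 0, 0; 0, 0, 0, 1; 0, 0, 1, 0] := by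
    have e : ∀ i j, (Matrix.of ![t, w, n, m] * Matrix.diagonal epsM *
        (Matrix.of ![t, w, n, m]).transpose) i j = mink (![t, w, n, m] i) (![t, w, n, m] j) := by
      intro i j
      rw [Matrix.mul_apply]
      simp only [Matrix.mul_diagonal, Matrix.transpose_apply, Matrix.of_apply, Fin.sum_univ_four,
        mink]
      simp [epsM]
      ring
    ext i j
    rw [e]
    fin_cases i <;> fin_cases j <;> simp [*, mink_comm _ t, mink_comm n w, mink_comm m]
  have hd := congrArg Matrix.det hG
  rw [Matrix.det_mul, Matrix.det_mul, Matrix.det_transpose, Matrix.det_diagonal] at hd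
  have h1 : Matrix.det !![(1 : ℝ), 0, 0, 0; 0, 1, 0, 0; 0, 0, 0, 1; 0, 0, 1, 0] = -1 := by
    simp [Matrix.det_succ_row_zero, Fin.sum_univ_succ, Fin.succAbove]
  have h2 : ∏ i, epsM i = -1 := by simp [epsM]
  rw [h1, h2] at hd
  unfold det4
  linarith

lemma eq_zero_of_orthogonal (h : IsWittFrame t w n m) {v : E4} (ht : mink v t = 0)
    (hw : mink v w = 0) (hn : mink v n = 0) (hm : mink v m = 0) : v = 0 := by
  have hdet : (Matrix.of ![t, w, n, m]).det ≠ 0 := by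
    intro h0
    have := h.det4_sq
    rw [det4, h0] at this
    norm_num at this
  have h0 : (fun i => epsM i * v i) = 0 := by
    apply Matrix.eq_zero_of_mulVec_eq_zero hdet
    simp only [mink] at ht hw hn hm
    ext i
    fin_cases i <;> simp [Matrix.mulVec, dotProduct, Fin.sum_univ_four, epsM] <;> linarith
  ext i
  have := congrFun h0 i
  fin_cases i <;> simpa [epsM] using this

lemma expansion (h : IsWittFrame t w n m) (v : E4) :
    v = mink v t • t + mink v w • w + mink v m • n + mink v n • m := by
  rw [← sub_eq_zero]
  apply h.eq_zero_of_orthogonal <;>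
    simp [mink_sub_left, mink_add_left, mink_smul_left, h.tt, h.ww, h.tw, h.tn, h.tm, h.wn, h.wm,
      h.nn, h.mm, h.nm, mink_comm w t, mink_comm n t, mink_comm m t, mink_comm n w, mink_comm m w,
      mink_comm m n]

lemma det4_eq_neg_one (h : IsWittFrame t w n m)
    (ho : 0 < det4 t w ((Real.sqrt 2)⁻¹ • (n + m)) ((Real.sqrt 2)⁻¹ • (n - m))) :
    det4 t w n m = -1 := by
  have hs : (Real.sqrt 2)⁻¹ * (Real.sqrt 2)⁻¹ = 1 / 2 := by
    rw [← mul_inv, Real.mul_self_sqrt (by norm_num)]; norm_num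
  have e : det4 t w ((Real.sqrt 2)⁻¹ • (n + m)) ((Real.sqrt 2)⁻¹ • (n - m)) =
      ((Real.sqrt 2)⁻¹ * (Real.sqrt 2)⁻¹) * (-2 * det4 t w n m) := by
    simp only [det4_eq, Pi.smul_apply, Pi.add_apply, Pi.sub_apply, smul_eq_mul]
    ring
  rw [e, hs] at ho
  rcases eq_or_eq_neg_of_sq_eq_sq _ 1 (h.det4_sq.trans (one_pow 2).symm) with h1 | h1 <;> linarith

end IsWittFrame

end MinkowskiAlgebra

section FlatCalculus

variable {U : Set Pt}

lemma contDiffOn_Dflat (hU : IsOpen U) {X : Pt → Pt} {V : Pt → E4}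
    (hX : ContDiffOn ℝ (⊤ : ℕ∞) X U) (hV : ContDiffOn ℝ (⊤ : ℕ∞) V U) :
    ContDiffOn ℝ (⊤ : ℕ∞) (Dflat X V) U :=
  (hV.fderiv_of_isOpen hU (by norm_cast)).clm_apply hX

lemma ContDiffOn.differentiableAt_of_isOpen {F : Type*} [NormedAddCommGroup F] [NormedSpace ℝ F]
    (hU : IsOpen U) {V : Pt → F} (hV : ContDiffOn ℝ (⊤ : ℕ∞) V U) {p : Pt} (hp : p ∈ U) :
    DifferentiableAt ℝ V p :=
  (hV.contDiffAt (hU.mem_nhds hp)).differentiableAt (by simp)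

lemma fderiv_Dflat (hU : IsOpen U) {X : Pt → Pt} {V : Pt → E4}
    (hX : ContDiffOn ℝ (⊤ : ℕ∞) X U) (hV : ContDiffOn ℝ (⊤ : ℕ∞) V U) {p : Pt} (hp : p ∈ U)
    (u : Pt) : fderiv ℝ (Dflat X V) p u =
      fderiv ℝ (fderiv ℝ V) p u (X p) + fderiv ℝ V p (fderiv ℝ X p u) := by
  have h1 : DifferentiableAt ℝ (fderiv ℝ V) p :=
    (hV.fderiv_of_isOpen (m := (⊤ : ℕ∞)) hU (by norm_cast)).differentiableAt_of_isOpen hU hp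
  have h2 := hX.differentiableAt_of_isOpen hU hp
  unfold Dflat
  rw [fderiv_clm_apply h1 h2]
  simp [add_comm]

lemma fderiv_fderiv_symm (hU : IsOpen U) {V : Pt → E4}
    (hV : ContDiffOn ℝ (⊤ : ℕ∞) V U) {p : Pt} (hp : p ∈ U) (u v : Pt) :
    fderiv ℝ (fderiv ℝ V) p u v = fderiv ℝ (fderiv ℝ V) p v u :=
  (hV.contDiffAt (hU.mem_nhds hp)).isSymmSndFDerivAt
    (by rw [minSmoothness_of_isRCLikeNormedField]; exact WithTop.coe_le_coe.2 (le_top (a := (2 : ℕ∞)))) u v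

/-- The flat connection has zero curvature. -/
lemma Dflat_curvature (hU : IsOpen U) {X Y : Pt → Pt} {V : Pt → E4}
    (hX : ContDiffOn ℝ (⊤ : ℕ∞) X U) (hY : ContDiffOn ℝ (⊤ : ℕ∞) Y U)
    (hV : ContDiffOn ℝ (⊤ : ℕ∞) V U) {p : Pt} (hp : p ∈ U) :
    Dflat Y (Dflat X V) p - Dflat X (Dflat Y V) p + Dflat (lieB X Y) V p = 0 := by
  have h1 : Dflat Y (Dflat X V) p = _ := fderiv_Dflat hU hX hV hp (Y p)
  have h2 : Dflat X (Dflat Y V) p = _ := fderiv_Dflat hU hY hV hp (X p)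
  rw [h1, h2, fderiv_fderiv_symm hU hV hp (X p) (Y p)]
  simp only [Dflat, lieB, map_sub]
  abel

lemma Dflat_congr (hU : IsOpen U) {X : Pt → Pt} {V V' : Pt → E4} (h : ∀ q ∈ U, V q = V' q)
    {p : Pt} (hp : p ∈ U) : Dflat X V p = Dflat X V' p := by
  have : V =ᶠ[nhds p] V' := Filter.eventually_of_mem (hU.mem_nhds hp) h
  unfold Dflat
  rw [this.fderiv_eq]

lemma Dflat_sub {X : Pt → Pt} {V V' : Pt → E4} {p : Pt} (hV : DifferentiableAt ℝ V p)
    (hV' : DifferentiableAt ℝ V' p) :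
    Dflat X (fun q => V q - V' q) p = Dflat X V p - Dflat X V' p := by
  unfold Dflat
  rw [fderiv_fun_sub hV hV']
  rfl

lemma Dflat_add {X : Pt → Pt} {V V' : Pt → E4} {p : Pt} (hV : DifferentiableAt ℝ V p)
    (hV' : DifferentiableAt ℝ V' p) :
    Dflat X (fun q => V q + V' q) p = Dflat X V p + Dflat X V' p := by
  unfold Dflat
  rw [fderiv_fun_add hV hV']
  rfl

/-- Leibniz rule for the wedge product of two vector fields. -/
lemma fderiv_wedge2 {V V' : Pt → E4} {p : Pt} (hV : DifferentiableAt ℝ V p)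
    (hV' : DifferentiableAt ℝ V' p) (u : Pt) :
    fderiv ℝ (fun q => wedge2 (V q) (V' q)) p u =
      wedge2 (fderiv ℝ V p u) (V' p) + wedge2 (V p) (fderiv ℝ V' p u) := by
  have h := hasFDerivAt_pi'.1 hV.hasFDerivAt
  have h' := hasFDerivAt_pi'.1 hV'.hasFDerivAt
  have key : HasFDerivAt (fun q => wedge2 (V q) (V' q)) _ p :=
    hasFDerivAt_pi.2 fun i => hasFDerivAt_pi.2 fun j =>
      ((h i).mul (h' j)).sub ((h j).mul (h' i))
  rw [key.fderiv]
  ext i j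
  simp [wedge2]
  ring

end FlatCalculus

namespace CNND

variable (S : CNND) {p : Pt}

lemma contDiffOn_vecF {X : Pt → Pt} (hX : ContDiffOn ℝ (⊤ : ℕ∞) X S.U) :
    ContDiffOn ℝ (⊤ : ℕ∞) (vecF S.ψ X) S.U :=
  contDiffOn_Dflat S.hUopen hX S.hψ

lemma contDiffOn_Zperp : ContDiffOn ℝ (⊤ : ℕ∞) S.Zperp S.U :=
  contDiffOn_const.sub (S.contDiffOn_vecF S.hZTsmooth)

lemma contDiffOn_sff {X Y : Pt → Pt} (hX : ContDiffOn ℝ (⊤ : ℕ∞) X S.U)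
    (hY : ContDiffOn ℝ (⊤ : ℕ∞) Y S.U) : ContDiffOn ℝ (⊤ : ℕ∞) (sff S.ψ S.conn X Y) S.U :=
  (contDiffOn_Dflat S.hUopen hX (S.contDiffOn_vecF hY)).sub
    (S.contDiffOn_vecF (S.hconnSmooth X Y hX hY))

lemma sff_normal (X : Pt → Pt) {Y : Pt → Pt} (hY : ContDiffOn ℝ (⊤ : ℕ∞) Y S.U) (hp : p ∈ S.U)
    (v : Pt) : mink (sff S.ψ S.conn X Y p) (fderiv ℝ S.ψ p v) = 0 :=
  S.hconn X Y p hp ((S.contDiffOn_vecF hY).differentiableAt_of_isOpen S.hUopen hp) v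

lemma mink_sff_tangent (X : Pt → Pt) {Y : Pt → Pt} (hY : ContDiffOn ℝ (⊤ : ℕ∞) Y S.U)
    (hp : p ∈ S.U) (v : Pt) :
    mink (Dflat X (vecF S.ψ Y) p) (fderiv ℝ S.ψ p v) =
      mink (vecF S.ψ (S.conn X Y) p) (fderiv ℝ S.ψ p v) := by
  have := S.sff_normal X hY hp v
  rw [sff, mink_sub_left] at this
  linarith

lemma mink_Dflat_normal (X Y : Pt → Pt) {ν : E4} (hν : isNormalV S.ψ p ν) :
    mink (Dflat X (vecF S.ψ Y) p) ν = mink (sff S.ψ S.conn X Y p) ν := by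
  rw [sff, mink_sub_left, mink_comm (vecF _ _ _), vecF, hν, sub_zero]

/-- The normal components of the second fundamental form are those of the Hessian of the chart. -/
lemma mink_sff_eq_hessian (X : Pt → Pt) {Y : Pt → Pt} (hY : ContDiffOn ℝ (⊤ : ℕ∞) Y S.U)
    (hp : p ∈ S.U) {ν : E4} (hν : isNormalV S.ψ p ν) :
    mink (sff S.ψ S.conn X Y p) ν = mink (fderiv ℝ (fderiv ℝ S.ψ) p (X p) (Y p)) ν := by
  rw [← S.mink_Dflat_normal X Y hν]
  have : Dflat X (vecF S.ψ Y) p = _ := fderiv_Dflat S.hUopen hY S.hψ hp (X p)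
  rw [this, mink_add_left, mink_comm (fderiv ℝ S.ψ p _), hν, add_zero]

lemma mink_sff_symm {X Y : Pt → Pt} (hX : ContDiffOn ℝ (⊤ : ℕ∞) X S.U)
    (hY : ContDiffOn ℝ (⊤ : ℕ∞) Y S.U) (hp : p ∈ S.U) {ν : E4} (hν : isNormalV S.ψ p ν) :
    mink (sff S.ψ S.conn X Y p) ν = mink (sff S.ψ S.conn Y X p) ν := by
  rw [S.mink_sff_eq_hessian X hY hp hν, S.mink_sff_eq_hessian Y hX hp hν,
    fderiv_fderiv_symm S.hUopen S.hψ hp]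

lemma isWittFrame (hp : p ∈ S.U) :
    IsWittFrame (vecF S.ψ S.ZT p) (vecF S.ψ S.Wc p) (S.Zperp p) (S.Wp p) where
  tt := by
    have h1 := S.hZunit
    have h2 := S.hZTtangentpart p hp (S.ZT p)
    have h3 := S.hZperpNull p hp
    simp only [mink_sub_left, mink_sub_right] at h2 h3
    rw [mink_comm (fderiv ℝ S.ψ p _) S.Z] at h3
    simp only [vecF]
    linarith
  ww := S.hWunit p hp
  tw := S.hWorth p hp
  tn := by rw [mink_comm]; exact S.hZTtangentpart p hp _
  tm := by rw [mink_comm]; exact S.hWpNormal p hp _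
  wn := by rw [mink_comm]; exact S.hZTtangentpart p hp _
  wm := by rw [mink_comm]; exact S.hWpNormal p hp _
  nn := S.hZperpNull p hp
  mm := S.hWpNull p hp
  nm := S.hWpPair p hp

lemma Zperp_normal (hp : p ∈ S.U) : isNormalV S.ψ p (S.Zperp p) := S.hZTtangentpart p hp

lemma sff_ZT (X : Pt → Pt) (hp : p ∈ S.U) :
    sff S.ψ S.conn X S.ZT p = S.beta p (X p) • S.Zperp p := S.hbeta X p hp

lemma Dflat_Zperp (X : Pt → Pt) (p : Pt) :
    Dflat X S.Zperp p = -Dflat X (vecF S.ψ S.ZT) p := by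
  have : S.Zperp = fun q => S.Z - vecF S.ψ S.ZT q := rfl
  rw [Dflat, this, fderiv_const_sub]
  rfl

lemma mink_Dflat_ZT_Wc {X : Pt → Pt} (hp : p ∈ S.U) :
    mink (Dflat X (vecF S.ψ S.ZT) p) (vecF S.ψ S.Wc p) =
      mink (sff S.ψ S.conn X S.Wc p) (S.Zperp p) := by
  have h := mink_deriv_eq_zero S.hUopen (V := S.Zperp) (V' := vecF S.ψ S.Wc) (c := 0)
    (fun q hq => S.Zperp_normal hq _) hp
    (S.contDiffOn_Zperp.differentiableAt_of_isOpen S.hUopen hp)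
    ((S.contDiffOn_vecF S.hWsmooth).differentiableAt_of_isOpen S.hUopen hp) (X p)
  have e := S.Dflat_Zperp X p
  have e2 := S.mink_Dflat_normal X S.Wc (S.Zperp_normal hp)
  simp only [Dflat] at e e2 ⊢
  rw [e, mink_neg_left, mink_comm (S.Zperp p)] at h
  linarith

lemma mink_Dflat_ZT_ZT {X : Pt → Pt} (hp : p ∈ S.U) :
    mink (Dflat X (vecF S.ψ S.ZT) p) (vecF S.ψ S.ZT p) = 0 := by
  have hd := (S.contDiffOn_vecF S.hZTsmooth).differentiableAt_of_isOpen S.hUopen hp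
  have h := mink_deriv_eq_zero S.hUopen (fun q hq => (S.isWittFrame hq).tt) hp hd hd (X p)
  rw [mink_comm (vecF S.ψ S.ZT p)] at h
  simp only [Dflat]
  linarith

lemma mink_Dflat_Wc_Wc {X : Pt → Pt} (hp : p ∈ S.U) :
    mink (Dflat X (vecF S.ψ S.Wc) p) (vecF S.ψ S.Wc p) = 0 := by
  have hd := (S.contDiffOn_vecF S.hWsmooth).differentiableAt_of_isOpen S.hUopen hp
  have h := mink_deriv_eq_zero S.hUopen (fun q hq => (S.isWittFrame hq).ww) hp hd hd (X p)
  rw [mink_comm (vecF S.ψ S.Wc p)] at h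
  simp only [Dflat]
  linarith

lemma mink_Dflat_Wc_ZT {X : Pt → Pt} (hp : p ∈ S.U) :
    mink (Dflat X (vecF S.ψ S.Wc) p) (vecF S.ψ S.ZT p) =
      -mink (sff S.ψ S.conn X S.Wc p) (S.Zperp p) := by
  have hd := (S.contDiffOn_vecF S.hZTsmooth).differentiableAt_of_isOpen S.hUopen hp
  have hd' := (S.contDiffOn_vecF S.hWsmooth).differentiableAt_of_isOpen S.hUopen hp
  have h := mink_deriv_eq_zero S.hUopen (fun q hq => (S.isWittFrame hq).tw) hp hd hd' (X p)
  have h2 := S.mink_Dflat_ZT_Wc (X := X) hp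
  rw [mink_comm (vecF S.ψ S.ZT p)] at h
  simp only [Dflat] at h2 ⊢
  linarith

lemma mink_sff_ZT_Wc_Zperp (hp : p ∈ S.U) :
    mink (sff S.ψ S.conn S.ZT S.Wc p) (S.Zperp p) = 0 := by
  rw [S.mink_sff_symm S.hZTsmooth S.hWsmooth hp (S.Zperp_normal hp), S.sff_ZT _ hp,
    mink_smul_left, (S.isWittFrame hp).nn, mul_zero]

lemma mink_sff_ZT_Wc_Wp (hp : p ∈ S.U) :
    mink (sff S.ψ S.conn S.ZT S.Wc p) (S.Wp p) = S.beta p (S.Wc p) := by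
  rw [S.mink_sff_symm S.hZTsmooth S.hWsmooth hp (S.hWpNormal p hp), S.sff_ZT _ hp,
    mink_smul_left, (S.isWittFrame hp).nm, mul_one]

lemma Dflat_ZT (X : Pt → Pt) (hp : p ∈ S.U) :
    Dflat X (vecF S.ψ S.ZT) p =
      mink (sff S.ψ S.conn X S.Wc p) (S.Zperp p) • vecF S.ψ S.Wc p +
        S.beta p (X p) • S.Zperp p := by
  have hF := S.isWittFrame hp
  rw [hF.expansion (Dflat X (vecF S.ψ S.ZT) p), S.mink_Dflat_ZT_ZT hp, S.mink_Dflat_ZT_Wc hp,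
    S.mink_Dflat_normal _ _ (S.hWpNormal p hp), S.mink_Dflat_normal _ _ (S.Zperp_normal hp),
    S.sff_ZT _ hp, mink_smul_left, mink_smul_left, hF.nn, hF.nm]
  simp

lemma Dflat_Wc (X : Pt → Pt) (hp : p ∈ S.U) :
    Dflat X (vecF S.ψ S.Wc) p =
      -(mink (sff S.ψ S.conn X S.Wc p) (S.Zperp p)) • vecF S.ψ S.ZT p +
        mink (sff S.ψ S.conn X S.Wc p) (S.Wp p) • S.Zperp p +
        mink (sff S.ψ S.conn X S.Wc p) (S.Zperp p) • S.Wp p := by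
  have hF := S.isWittFrame hp
  rw [hF.expansion (Dflat X (vecF S.ψ S.Wc) p), S.mink_Dflat_Wc_ZT hp, S.mink_Dflat_Wc_Wc hp,
    S.mink_Dflat_normal _ _ (S.hWpNormal p hp), S.mink_Dflat_normal _ _ (S.Zperp_normal hp)]
  simp

/-- The tangent vector field `∇_X Z^⊤` is `⟨B(X,W), Z^⊥⟩ W`. -/
lemma conn_ZT (X : Pt → Pt) (hp : p ∈ S.U) :
    S.conn X S.ZT p = mink (sff S.ψ S.conn X S.Wc p) (S.Zperp p) • S.Wc p := by
  rw [← sub_eq_zero]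
  apply S.himm p hp
  have h1 := S.sff_ZT X hp
  rw [sff, S.Dflat_ZT X hp, sub_eq_iff_eq_add, add_comm] at h1
  have h2 := add_left_cancel h1
  rw [map_sub, map_smul, sub_eq_zero]
  exact h2.symm

lemma sff_Wc_Wc (hp : p ∈ S.U) :
    sff S.ψ S.conn S.Wc S.Wc p =
      mink (sff S.ψ S.conn S.Wc S.Wc p) (S.Wp p) • S.Zperp p + S.afun p • S.Wp p := by
  have hF := S.isWittFrame hp
  have e := hF.expansion (sff S.ψ S.conn S.Wc S.Wc p)
  have h1 : mink (sff S.ψ S.conn S.Wc S.Wc p) (vecF S.ψ S.ZT p) = 0 :=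
    S.sff_normal S.Wc S.hWsmooth hp (S.ZT p)
  have h2 : mink (sff S.ψ S.conn S.Wc S.Wc p) (vecF S.ψ S.Wc p) = 0 :=
    S.sff_normal S.Wc S.hWsmooth hp (S.Wc p)
  rw [h1, h2, zero_smul, zero_smul, zero_add, zero_add] at e
  exact e

/-- Differentiating the orthogonality of `B(Y, V)` and a tangent field `Q`. -/
lemma mink_Dflat_sff (X : Pt → Pt) {Y V Q : Pt → Pt} (hY : ContDiffOn ℝ (⊤ : ℕ∞) Y S.U)
    (hV : ContDiffOn ℝ (⊤ : ℕ∞) V S.U) (hQ : ContDiffOn ℝ (⊤ : ℕ∞) Q S.U) (hp : p ∈ S.U) :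
    mink (Dflat X (sff S.ψ S.conn Y V) p) (vecF S.ψ Q p) =
      -mink (sff S.ψ S.conn Y V p) (sff S.ψ S.conn X Q p) := by
  have h := mink_deriv_eq_zero S.hUopen (fun q hq => S.sff_normal Y hV hq (Q q)) hp
    ((S.contDiffOn_sff hY hV).differentiableAt_of_isOpen S.hUopen hp)
    ((S.contDiffOn_vecF hQ).differentiableAt_of_isOpen S.hUopen hp) (X p)
  have h2 := S.mink_Dflat_normal X Q
    (S.hconn Y V p hp ((S.contDiffOn_vecF hV).differentiableAt_of_isOpen S.hUopen hp))
  rw [mink_comm (sff S.ψ S.conn Y V p) (sff S.ψ S.conn X Q p), ← h2,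
    mink_comm (Dflat X (vecF S.ψ Q) p)]
  exact eq_neg_of_add_eq_zero_left h

/-- The tangential part of an iterated flat derivative. -/
lemma mink_vecF_conn_conn {X Y V Q : Pt → Pt} (hX : ContDiffOn ℝ (⊤ : ℕ∞) X S.U)
    (hV : ContDiffOn ℝ (⊤ : ℕ∞) V S.U) (hQ : ContDiffOn ℝ (⊤ : ℕ∞) Q S.U) (hp : p ∈ S.U) :
    mink (vecF S.ψ (S.conn Y (S.conn X V)) p) (vecF S.ψ Q p) =
      mink (Dflat Y (Dflat X (vecF S.ψ V)) p) (vecF S.ψ Q p) +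
        mink (sff S.ψ S.conn X V p) (sff S.ψ S.conn Y Q p) := by
  have h1 : mink (Dflat Y (vecF S.ψ (S.conn X V)) p) (vecF S.ψ Q p) = _ :=
    S.mink_sff_tangent Y (S.hconnSmooth X V hX hV) hp (Q p)
  have h2 : Dflat Y (vecF S.ψ (S.conn X V)) p =
      Dflat Y (fun q => Dflat X (vecF S.ψ V) q - sff S.ψ S.conn X V q) p :=
    Dflat_congr S.hUopen (fun q _ => by simp [sff]) hp
  have hV' := S.contDiffOn_vecF hV
  rw [Dflat_sub ((contDiffOn_Dflat S.hUopen hX hV').differentiableAt_of_isOpen S.hUopen hp)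
    ((S.contDiffOn_sff hX hV).differentiableAt_of_isOpen S.hUopen hp)] at h2
  have h3 := S.mink_Dflat_sff Y hX hV hQ hp
  rw [h2, mink_sub_left, h3] at h1
  simp only [vecF] at h1 ⊢
  linarith

/-- The Gauss equation. -/
lemma gauss_equation {X Y V Q : Pt → Pt} (hX : ContDiffOn ℝ (⊤ : ℕ∞) X S.U)
    (hY : ContDiffOn ℝ (⊤ : ℕ∞) Y S.U) (hV : ContDiffOn ℝ (⊤ : ℕ∞) V S.U)
    (hQ : ContDiffOn ℝ (⊤ : ℕ∞) Q S.U) (hp : p ∈ S.U) :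
    mink (fderiv ℝ S.ψ p (curvR S.conn X Y V p)) (fderiv ℝ S.ψ p (Q p)) =
      mink (sff S.ψ S.conn X V p) (sff S.ψ S.conn Y Q p) -
        mink (sff S.ψ S.conn Y V p) (sff S.ψ S.conn X Q p) := by
  have h1 := S.mink_vecF_conn_conn (Y := Y) hX hV hQ hp
  have h2 := S.mink_vecF_conn_conn (Y := X) hY hV hQ hp
  have h3 := S.mink_sff_tangent (lieB X Y) hV hp (Q p)
  have h4 := congrArg (fun v => mink v (vecF S.ψ Q p))
    (Dflat_curvature S.hUopen hX hY (S.contDiffOn_vecF hV) hp)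
  simp only [mink_add_left, mink_sub_left, mink_zero_left] at h4
  simp only [curvR, map_add, map_sub, mink_add_left, mink_sub_left]
  simp only [vecF] at h1 h2 h3 h4 ⊢
  linarith

lemma nconn_Zperp (X : Pt → Pt) (hp : p ∈ S.U) :
    S.nconn X S.Zperp p = -sff S.ψ S.conn X S.ZT p := by
  obtain ⟨hn, w, hw⟩ := S.hnconn X S.Zperp p hp (fun q hq => S.Zperp_normal hq)
    (S.contDiffOn_Zperp.differentiableAt_of_isOpen S.hUopen hp)
  have hF := S.isWittFrame hp
  have e : S.nconn X S.Zperp p + sff S.ψ S.conn X S.ZT p =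
      -fderiv ℝ S.ψ p (w + S.conn X S.ZT p) := by
    rw [map_add, hw, S.Dflat_Zperp, sff, vecF]
    abel
  have hnorm : ∀ v, mink (S.nconn X S.Zperp p + sff S.ψ S.conn X S.ZT p) (fderiv ℝ S.ψ p v) = 0 :=
    fun v => by rw [mink_add_left, hn, S.sff_normal X S.hZTsmooth hp, add_zero]
  rw [← add_eq_zero_iff_eq_neg]
  apply hF.eq_zero_of_orthogonal (hnorm _) (hnorm _)
  · rw [e, mink_neg_left, mink_comm, S.Zperp_normal hp, neg_zero]
  · rw [e, mink_neg_left, mink_comm, S.hWpNormal p hp, neg_zero]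

lemma mink_nconn_nconn_Zperp {X : Pt → Pt} (Y : Pt → Pt) (hX : ContDiffOn ℝ (⊤ : ℕ∞) X S.U)
    (hp : p ∈ S.U) {ν : E4} (hν : isNormalV S.ψ p ν) :
    mink (S.nconn Y (S.nconn X S.Zperp) p) ν =
      mink (Dflat Y (Dflat X S.Zperp) p) ν +
        mink (sff S.ψ S.conn Y (S.conn X S.ZT) p) ν := by
  have hsm := S.hnconnSmooth X S.Zperp hX (fun q hq => S.Zperp_normal hq) S.contDiffOn_Zperp
  obtain ⟨-, w, hw⟩ := S.hnconn Y (S.nconn X S.Zperp) p hp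
    (fun q hq => (S.hnconn X S.Zperp q hq (fun r hr => S.Zperp_normal hr)
      (S.contDiffOn_Zperp.differentiableAt_of_isOpen S.hUopen hq)).1)
    (hsm.differentiableAt_of_isOpen S.hUopen hp)
  have h1 : Dflat Y (S.nconn X S.Zperp) p =
      Dflat Y (fun q => Dflat X S.Zperp q + vecF S.ψ (S.conn X S.ZT) q) p :=
    Dflat_congr S.hUopen
      (fun q hq => by rw [S.nconn_Zperp X hq, S.Dflat_Zperp, sff]; abel) hp
  rw [Dflat_add
    ((contDiffOn_Dflat S.hUopen hX S.contDiffOn_Zperp).differentiableAt_of_isOpen S.hUopen hp)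
    ((S.contDiffOn_vecF (S.hconnSmooth _ _ hX S.hZTsmooth)).differentiableAt_of_isOpen
      S.hUopen hp)] at h1
  have h2 : mink (Dflat Y (S.nconn X S.Zperp) p - S.nconn Y (S.nconn X S.Zperp) p) ν = 0 := by
    rw [← hw, mink_comm, hν]
  rw [h1, mink_sub_left, mink_add_left, S.mink_Dflat_normal _ _ hν] at h2
  linarith

/-- The Ricci equation for `Z^⊥`. -/
lemma ricci_equation_Zperp {X Y : Pt → Pt} (hX : ContDiffOn ℝ (⊤ : ℕ∞) X S.U)
    (hY : ContDiffOn ℝ (⊤ : ℕ∞) Y S.U) (hp : p ∈ S.U) {ν : E4} (hν : isNormalV S.ψ p ν) :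
    mink (curvRperp S.nconn X Y S.Zperp p) ν =
      mink (sff S.ψ S.conn Y (S.conn X S.ZT) p) ν -
        mink (sff S.ψ S.conn X (S.conn Y S.ZT) p) ν := by
  have h1 := S.mink_nconn_nconn_Zperp Y hX hp hν
  have h2 := S.mink_nconn_nconn_Zperp X hY hp hν
  have h3 : mink (S.nconn (lieB X Y) S.Zperp p) ν = mink (Dflat (lieB X Y) S.Zperp p) ν := by
    rw [S.nconn_Zperp _ hp, S.Dflat_Zperp, mink_neg_left, mink_neg_left,
      S.mink_Dflat_normal _ _ hν]
  have h4 := congrArg (fun v => mink v ν)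
    (Dflat_curvature S.hUopen hX hY S.contDiffOn_Zperp hp)
  simp only [mink_add_left, mink_sub_left, mink_zero_left] at h4
  simp only [curvRperp, mink_add_left, mink_sub_left]
  linarith

lemma Kfun_eq (hp : p ∈ S.U) : S.Kfun p = S.beta p (S.ZT p) * S.afun p := by
  have hF := S.isWittFrame hp
  have e : S.Kfun p = _ :=
    S.gauss_equation S.hZTsmooth S.hWsmooth S.hZTsmooth S.hWsmooth hp
  rw [e, S.sff_ZT _ hp, S.sff_ZT _ hp, mink_smul_left, mink_smul_left,
    mink_comm (S.Zperp p) (sff _ _ S.ZT _ _), S.mink_sff_ZT_Wc_Zperp hp, mink_comm (S.Zperp p)]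
  simp [afun, B]

lemma KNfun_eq (hp : p ∈ S.U) : S.KNfun p = -(S.afun p * S.beta p (S.Wc p)) := by
  have hν := S.hWpNormal p hp
  have e : S.KNfun p = _ := S.ricci_equation_Zperp S.hZTsmooth S.hWsmooth hp hν
  rw [e, S.mink_sff_eq_hessian _ (S.hconnSmooth _ _ S.hZTsmooth S.hZTsmooth) hp hν,
    S.mink_sff_eq_hessian _ (S.hconnSmooth _ _ S.hWsmooth S.hZTsmooth) hp hν,
    S.conn_ZT _ hp, S.conn_ZT _ hp, S.mink_sff_ZT_Wc_Zperp hp, zero_smul, map_zero, map_smul,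
    mink_smul_left, ← S.mink_sff_eq_hessian _ S.hWsmooth hp hν, S.mink_sff_ZT_Wc_Wp hp,
    mink_zero_left]
  simp [afun, B]

lemma mink_Hvec (hp : p ∈ S.U) : mink (S.Hvec p) (S.Hvec p) =
    S.afun p * (S.beta p (S.ZT p) + mink (sff S.ψ S.conn S.Wc S.Wc p) (S.Wp p)) / 2 := by
  have hF := S.isWittFrame hp
  have e : S.Hvec p = (1 / 2 : ℝ) • (sff S.ψ S.conn S.ZT S.ZT p + sff S.ψ S.conn S.Wc S.Wc p) :=
    rfl
  rw [e, S.sff_ZT _ hp, S.sff_Wc_Wc hp]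
  generalize mink (sff S.ψ S.conn S.Wc S.Wc p) (S.Wp p) = c
  simp only [mink_smul_left, mink_smul_right, mink_add_left, mink_add_right, hF.nn, hF.mm, hF.nm,
    mink_comm (S.Wp p) (S.Zperp p)]
  ring

lemma fderiv_Gmap (X : Pt → Pt) (hp : p ∈ S.U) : fderiv ℝ S.Gmap p (X p) =
    wedge2 (Dflat X (vecF S.ψ S.ZT) p) (vecF S.ψ S.Wc p) +
      wedge2 (vecF S.ψ S.ZT p) (Dflat X (vecF S.ψ S.Wc) p) :=
  fderiv_wedge2 ((S.contDiffOn_vecF S.hZTsmooth).differentiableAt_of_isOpen S.hUopen hp)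
    ((S.contDiffOn_vecF S.hWsmooth).differentiableAt_of_isOpen S.hUopen hp) (X p)

lemma fderiv_Gmap_ZT (hp : p ∈ S.U) : fderiv ℝ S.Gmap p (S.ZT p) =
    wedge2 (S.Zperp p)
      (S.beta p (S.ZT p) • vecF S.ψ S.Wc p - S.beta p (S.Wc p) • vecF S.ψ S.ZT p) := by
  rw [S.fderiv_Gmap _ hp, S.Dflat_ZT _ hp, S.Dflat_Wc _ hp, S.mink_sff_ZT_Wc_Zperp hp,
    S.mink_sff_ZT_Wc_Wp hp]
  ext i j
  simp [wedge2]
  ring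

lemma fderiv_Gmap_Wc (hp : p ∈ S.U) : fderiv ℝ S.Gmap p (S.Wc p) =
    wedge2 (S.Zperp p) (S.beta p (S.Wc p) • vecF S.ψ S.Wc p) +
      wedge2 (vecF S.ψ S.ZT p)
        (mink (sff S.ψ S.conn S.Wc S.Wc p) (S.Wp p) • S.Zperp p + S.afun p • S.Wp p) := by
  have ea : mink (sff S.ψ S.conn S.Wc S.Wc p) (S.Zperp p) = S.afun p := rfl
  rw [S.fderiv_Gmap _ hp, S.Dflat_ZT _ hp, S.Dflat_Wc _ hp, ea]
  ext i j
  simp [wedge2]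
  ring

end CNND

lemma binner_add_left (η θ ζ : Fin 4 → Fin 4 → ℝ) :
    binner (η + θ) ζ = binner η ζ + binner θ ζ := by
  simp only [binner, Pi.add_apply, mul_add, add_mul, Finset.sum_add_distrib]

lemma binner_add_right (η θ ζ : Fin 4 → Fin 4 → ℝ) :
    binner η (θ + ζ) = binner η θ + binner η ζ := by
  simp only [binner, Pi.add_apply, mul_add, Finset.sum_add_distrib]

lemma bwedge_add_left (η θ ζ : Fin 4 → Fin 4 → ℝ) :
    bwedge (η + θ) ζ = bwedge η ζ + bwedge θ ζ := by
  simp only [bwedge, Pi.add_apply, mul_add, add_mul, Finset.sum_add_distrib]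

lemma bwedge_add_right (η θ ζ : Fin 4 → Fin 4 → ℝ) :
    bwedge η (θ + ζ) = bwedge η θ + bwedge η ζ := by
  simp only [bwedge, Pi.add_apply, mul_add, Finset.sum_add_distrib]

namespace IsWittFrame

variable {t w n m : E4}

lemma HformC_null (h : IsWittFrame t w n m) (x y : ℝ) :
    HformC (wedge2 n (x • w - y • t)) (wedge2 n (x • w - y • t)) = 0 := by
  have h1 : det4 n (x • w - y • t) n (x • w - y • t) = 0 := by
    simp only [det4_eq]; ring
  simp [HformC, binner_wedge2, bwedge_wedge2, h1, mink_sub_right, mink_smul_right,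
    h.nn, mink_comm n w, mink_comm n t, h.tn, h.wn]

lemma HformC_mixed (h : IsWittFrame t w n m) (hd : det4 t w n m = -1) (x y a c : ℝ) :
    HformC (wedge2 n (x • w - y • t)) (wedge2 n (y • w) + wedge2 t (c • n + a • m)) =
      ((a * y : ℝ) : ℂ) + ((x * a : ℝ) : ℂ) * Complex.I := by
  have h1 : det4 n (x • w - y • t) n (y • w) = 0 := by
    simp only [det4_eq]; ring
  have h2 : det4 n (x • w - y • t) t (c • n + a • m) = -(x * a) * det4 t w n m := by
    simp only [det4_eq, Pi.smul_apply, Pi.sub_apply, Pi.add_apply, smul_eq_mul]; ring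
  simp only [HformC, binner_add_right, bwedge_add_right, binner_wedge2, bwedge_wedge2, h1, h2, hd,
    mink_sub_left, mink_add_right, mink_smul_left, mink_smul_right, mink_comm n w, mink_comm n t,
    mink_comm w t, h.tt, h.ww, h.tw, h.tn, h.tm, h.wn, h.wm, h.nn, h.nm]
  push_cast
  ring

lemma HformC_self (h : IsWittFrame t w n m) (hd : det4 t w n m = -1) (y a c : ℝ) :
    HformC (wedge2 n (y • w) + wedge2 t (c • n + a • m))
        (wedge2 n (y • w) + wedge2 t (c • n + a • m)) =
      ((2 * a * c : ℝ) : ℂ) + ((2 * a * y : ℝ) : ℂ) * Complex.I := by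
  have h1 : det4 n (y • w) n (y • w) = 0 := by
    simp only [det4_eq]; ring
  have h2 : det4 n (y • w) t (c • n + a • m) = -(y * a) * det4 t w n m := by
    simp only [det4_eq, Pi.smul_apply, Pi.add_apply, smul_eq_mul]; ring
  have h3 : det4 t (c • n + a • m) n (y • w) = -(y * a) * det4 t w n m := by
    simp only [det4_eq, Pi.smul_apply, Pi.add_apply, smul_eq_mul]; ring
  have h4 : det4 t (c • n + a • m) t (c • n + a • m) = 0 := by
    simp only [det4_eq]; ring
  simp only [HformC, binner_add_right, bwedge_add_right, binner_add_left, bwedge_add_left,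
    binner_wedge2, bwedge_wedge2, h1, h2, h3, h4, hd,
    mink_add_left, mink_add_right, mink_smul_left, mink_smul_right, mink_comm n w, mink_comm n t,
    mink_comm w t, mink_comm m n, mink_comm m t, mink_comm m w,
    h.tt, h.ww, h.tw, h.tn, h.tm, h.wn, h.wm, h.nn, h.nm, h.mm]
  push_cast
  ring

end IsWittFrame

/-- If `a ≠ 0`, the complex quadratic form `G*H` satisfies
`H(dG(Z^⊤),dG(Z^⊤)) = 0`, `H(dG(W),dG(W)) = 2(2|H⃗|² − K) − i·2K_N`, and
`H(dG(Z^⊤),dG(W)) = −K_N + iK`; consequently its discriminant satisfies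
`disc G*H := −det G*H = −(K + iK_N)²`. -/
theorem cnnd_pullback_H_form (S : CNND) (ha : ∀ p ∈ S.U, S.afun p ≠ 0)
    (hG : ∀ p ∈ S.U, DifferentiableAt ℝ S.Gmap p) :
    ∀ p ∈ S.U,
      HformC (fderiv ℝ S.Gmap p (S.ZT p)) (fderiv ℝ S.Gmap p (S.ZT p)) = 0 ∧
      HformC (fderiv ℝ S.Gmap p (S.Wc p)) (fderiv ℝ S.Gmap p (S.Wc p)) =
        ((2 * (2 * mink (S.Hvec p) (S.Hvec p) - S.Kfun p) : ℝ) : ℂ) -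
          ((2 * S.KNfun p : ℝ) : ℂ) * Complex.I ∧
      HformC (fderiv ℝ S.Gmap p (S.ZT p)) (fderiv ℝ S.Gmap p (S.Wc p)) =
        ((-S.KNfun p : ℝ) : ℂ) + ((S.Kfun p : ℝ) : ℂ) * Complex.I ∧
      -(HformC (fderiv ℝ S.Gmap p (S.ZT p)) (fderiv ℝ S.Gmap p (S.ZT p)) *
            HformC (fderiv ℝ S.Gmap p (S.Wc p)) (fderiv ℝ S.Gmap p (S.Wc p)) -
          HformC (fderiv ℝ S.Gmap p (S.ZT p)) (fderiv ℝ S.Gmap p (S.Wc p)) ^ 2) =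
        -(((S.Kfun p : ℝ) : ℂ) + ((S.KNfun p : ℝ) : ℂ) * Complex.I) ^ 2 := by
  intro p hp
  have hF := S.isWittFrame hp
  have hd := hF.det4_eq_neg_one (S.hWpOrient p hp)
  have h1 : HformC (fderiv ℝ S.Gmap p (S.ZT p)) (fderiv ℝ S.Gmap p (S.ZT p)) = 0 := by
    rw [S.fderiv_Gmap_ZT hp, hF.HformC_null]
  have h2 : HformC (fderiv ℝ S.Gmap p (S.ZT p)) (fderiv ℝ S.Gmap p (S.Wc p)) =
      ((-S.KNfun p : ℝ) : ℂ) + ((S.Kfun p : ℝ) : ℂ) * Complex.I := by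
    rw [S.fderiv_Gmap_ZT hp, S.fderiv_Gmap_Wc hp, hF.HformC_mixed hd, S.Kfun_eq hp, S.KNfun_eq hp,
      neg_neg]
  refine ⟨h1, ?_, h2, ?_⟩
  · rw [S.fderiv_Gmap_Wc hp, hF.HformC_self hd, S.Kfun_eq hp, S.KNfun_eq hp, S.mink_Hvec hp]
    push_cast
    ring
  · rw [h1, h2]
    push_cast
    linear_combination (S.Kfun p ^ 2 + S.KNfun p ^ 2 : ℂ) * Complex.I_sq

end
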